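/- Let S : Δ → ℝ³ be a strictly proper scoring rule satisfying the technical assumptions and the budget-constrained truthfulness property. Then for any pair p, q₀ ∈ Δ, setting q = ½p + ½q₀ and b = nb(q₀, q), we have b > 0 and q is the maximizer of p·S(·) over the set of feasible reports {q' ∈ Δ : nb(q₀, q') ≤ b}. -/

import Mathlib

open scoped BigOperators

noncomputable section

/-- The probability simplex over the three outcomes `X, Y, Z` (identified with `0, 1, 2`). -/
def simplex3 : Set (Fin 3 → ℝ) := {q | (∀ i, 0 ≤ q i) ∧ ∑ i, q i = 1}

/-- The relative interior of the simplex: all coordinates strictly positive. -/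
def relint3 : Set (Fin 3 → ℝ) := {q | (∀ i, 0 < q i) ∧ ∑ i, q i = 1}

/-- Dot product of two vectors in `ℝ³`. -/
def dot3 (p s : Fin 3 → ℝ) : ℝ := ∑ i, p i * s i

/-- A scoring rule `S : Δ → ℝ³` is strictly proper if for all `p ≠ q` in the simplex,
`p·S(p) > p·S(q)`. -/
def StrictlyProper3 (S : (Fin 3 → ℝ) → Fin 3 → ℝ) : Prop :=
  ∀ p ∈ simplex3, ∀ q ∈ simplex3, p ≠ q → dot3 p (S q) < dot3 p (S p)

/-- Each component `S_i` is quasiconcave: `S_i(½p + ½q) ≥ min (S_i p) (S_i q)`, with equality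
only if `S_i p = S_i q`. -/
def QuasiConcave3 (S : (Fin 3 → ℝ) → Fin 3 → ℝ) : Prop :=
  ∀ i : Fin 3, ∀ p ∈ simplex3, ∀ q ∈ simplex3,
    min (S p i) (S q i) ≤ S ((1/2 : ℝ) • p + (1/2 : ℝ) • q) i ∧
    (S ((1/2 : ℝ) • p + (1/2 : ℝ) • q) i = min (S p i) (S q i) → S p i = S q i)

/-- The technical assumptions: continuity on the simplex, differentiability on its relative
interior, and componentwise quasiconcavity. -/
def Tech3 (S : (Fin 3 → ℝ) → Fin 3 → ℝ) : Prop :=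
  ContinuousOn S simplex3 ∧ DifferentiableOn ℝ S relint3 ∧ QuasiConcave3 S

/-- The natural budget required to move from `q₀` to `q`: the worst-case loss
`max_i (S_i(q₀) − S_i(q))`. -/
def nb3 (S : (Fin 3 → ℝ) → Fin 3 → ℝ) (q₀ q : Fin 3 → ℝ) : ℝ :=
  max (S q₀ 0 - S q 0) (max (S q₀ 1 - S q 1) (S q₀ 2 - S q 2))

/-- The budget-constrained truthfulness property: for every belief `p`, reference point `q₀`
and budget `b > 0`, the expected score `p·S(q)` over feasible reports (`q ∈ Δ` with
`nb(q₀,q) ≤ b`) is uniquely maximized at `q* = α p + (1−α) q₀`, where `α` is the largest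
element of `{α ∈ [0,1] : nb(q₀, α p + (1−α) q₀) ≤ b}`. -/
def BCT3 (S : (Fin 3 → ℝ) → Fin 3 → ℝ) : Prop :=
  ∀ p ∈ simplex3, ∀ q₀ ∈ simplex3, ∀ b : ℝ, 0 < b →
    ∃ α : ℝ,
      IsGreatest {a : ℝ | a ∈ Set.Icc (0:ℝ) 1 ∧
        nb3 S q₀ (a • p + (1 - a) • q₀) ≤ b} α ∧
      ∀ q ∈ simplex3, nb3 S q₀ q ≤ b → q ≠ α • p + (1 - α) • q₀ →
        dot3 p (S q) < dot3 p (S (α • p + (1 - α) • q₀))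

theorem simplex3_eq : simplex3 = stdSimplex ℝ (Fin 3) := rfl

theorem simplex3_compact : IsCompact simplex3 := by
  rw [simplex3_eq]; exact isCompact_stdSimplex ℝ (Fin 3)

theorem simplex3_comb {p q : Fin 3 → ℝ} (hp : p ∈ simplex3) (hq : q ∈ simplex3) {a : ℝ}
    (h0 : 0 ≤ a) (h1 : a ≤ 1) : a • p + (1 - a) • q ∈ simplex3 := by
  rw [simplex3_eq] at *
  exact convex_stdSimplex ℝ (Fin 3) hp hq h0 (by linarith) (by ring)

theorem single_mem (j : Fin 3) : (Pi.single j 1 : Fin 3 → ℝ) ∈ simplex3 := by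
  rw [simplex3_eq]; exact single_mem_stdSimplex ℝ j

theorem dot3_single (j : Fin 3) (s : Fin 3 → ℝ) : dot3 (Pi.single j 1) s = s j := by
  unfold dot3; simp [Pi.single_apply]

theorem nb3_le {S : (Fin 3 → ℝ) → Fin 3 → ℝ} {q₀ q : Fin 3 → ℝ} {b : ℝ} :
    nb3 S q₀ q ≤ b ↔ ∀ i, S q₀ i - S q i ≤ b := by
  simp [nb3, Fin.forall_fin_succ]

theorem nb3_pos {S : (Fin 3 → ℝ) → Fin 3 → ℝ} (hSP : StrictlyProper3 S) {q₀ q : Fin 3 → ℝ}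
    (h₀ : q₀ ∈ simplex3) (h : q ∈ simplex3) (hne : q₀ ≠ q) : 0 < nb3 S q₀ q := by
  by_contra hc
  have h1 := nb3_le.1 (not_lt.1 hc)
  have h2 := hSP q₀ h₀ q h hne
  have h3 : dot3 q₀ (S q₀) ≤ dot3 q₀ (S q) := by
    unfold dot3
    exact Finset.sum_le_sum fun i _ => mul_le_mul_of_nonneg_left (by linarith [h1 i]) (h₀.1 i)
  linarith

theorem comp_cont {S : (Fin 3 → ℝ) → Fin 3 → ℝ} (hc : ContinuousOn S simplex3) (i : Fin 3) :
    ContinuousOn (fun q => S q i) simplex3 :=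
  (continuous_apply i).comp_continuousOn hc

theorem dot_cont {S : (Fin 3 → ℝ) → Fin 3 → ℝ} (hc : ContinuousOn S simplex3) (u : Fin 3 → ℝ) :
    ContinuousOn (fun q => dot3 q (S q - u)) simplex3 := by
  unfold dot3
  refine continuousOn_finsetSum _ fun i _ => ?_
  exact (continuous_apply i).continuousOn.mul ((comp_cont hc i).sub continuousOn_const)

/-- Minimising the convex function `p·S(p) - p·u`. -/
theorem lemA {S : (Fin 3 → ℝ) → Fin 3 → ℝ} (hSP : StrictlyProper3 S)
    (hc : ContinuousOn S simplex3) (u : Fin 3 → ℝ) :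
    ∃ r ∈ simplex3, ∀ i, dot3 r (S r - u) ≤ S r i - u i := by
  obtain ⟨r, hr, hmin⟩ := simplex3_compact.exists_isMinOn ⟨_, single_mem 0⟩ (dot_cont hc u)
  refine ⟨r, hr, fun i => ?_⟩
  set e : Fin 3 → ℝ := Pi.single i 1 with he
  have hem : e ∈ simplex3 := single_mem i
  let γ : ℝ → Fin 3 → ℝ := fun t => t • e + (1 - t) • r
  have hγc : Continuous γ := by fun_prop
  have hγm : Set.MapsTo γ (Set.Icc 0 1) simplex3 := fun t ht => simplex3_comb hem hr ht.1 ht.2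
  have hγ0 : γ 0 = r := by simp [γ]
  let g : ℝ → ℝ := fun t => ∑ k, (e k - r k) * (S (γ t) k - u k)
  have hgc : ContinuousOn g (Set.Icc 0 1) := by
    refine continuousOn_finsetSum _ fun k _ => continuousOn_const.mul (ContinuousOn.sub ?_ continuousOn_const)
    exact (comp_cont hc k).comp hγc.continuousOn hγm
  have hpos : ∀ t ∈ Set.Ioc (0:ℝ) 1, 0 ≤ g t := by
    intro t ht
    have hm := hγm ⟨ht.1.le, ht.2⟩
    have h1 : dot3 r (S r - u) ≤ dot3 (γ t) (S (γ t) - u) := hmin hm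
    have h2 : dot3 r (S (γ t)) ≤ dot3 r (S r) := by
      by_cases hEq : r = γ t
      · rw [← hEq]
      · exact (hSP r hr _ hm hEq).le
    have h3 : dot3 (γ t) (S (γ t) - u) - dot3 r (S r - u)
        = t * g t + (dot3 r (S (γ t)) - dot3 r (S r)) := by
      simp only [dot3, g, Fin.sum_univ_three, Pi.sub_apply]
      simp only [γ, Pi.add_apply, Pi.smul_apply, smul_eq_mul]
      ring
    have h4 : 0 ≤ t * g t := by linarith
    exact nonneg_of_mul_nonneg_right h4 ht.1
  have hg0 : 0 ≤ g 0 := by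
    have ht : Filter.Tendsto g (nhdsWithin 0 (Set.Ioc 0 1)) (nhds (g 0)) :=
      (hgc 0 (by simp)).mono_left (nhdsWithin_mono _ Set.Ioc_subset_Icc_self)
    have : (nhdsWithin (0:ℝ) (Set.Ioc 0 1)).NeBot := by
      rw [nhdsWithin_Ioc_eq_nhdsGT (by norm_num)]; infer_instance
    exact ge_of_tendsto ht (eventually_mem_nhdsWithin.mono hpos)
  have h5 : dot3 e (S r - u) = S r i - u i := by rw [he, dot3_single]; rfl
  have h6 : g 0 = dot3 e (S r - u) - dot3 r (S r - u) := by
    simp only [g, hγ0, dot3, Fin.sum_univ_three, Pi.sub_apply]; ring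
  linarith

theorem lemB {S : (Fin 3 → ℝ) → Fin 3 → ℝ} (hSP : StrictlyProper3 S)
    (hc : ContinuousOn S simplex3) {q : Fin 3 → ℝ} (hq : q ∈ simplex3) (w : Fin 3 → ℝ)
    (hw : dot3 q w < 0) :
    ∃ ε₀ > 0, ∀ ε, 0 < ε → ε < ε₀ → ∃ r ∈ simplex3, ∀ i, S q i + ε * w i < S r i := by
  have hwc : Continuous (fun p : Fin 3 → ℝ => dot3 p w) := by unfold dot3; fun_prop
  have key : ∃ ε₀ > 0, ∀ ε, 0 < ε → ε < ε₀ → ∀ p ∈ simplex3,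
      0 < dot3 p (S p - S q) - ε * dot3 p w := by
    have hnn : ∀ p ∈ simplex3, p ≠ q → 0 < dot3 p (S p - S q) := by
      intro p hp hne
      have := hSP p hp q hq hne
      have h : dot3 p (S p - S q) = dot3 p (S p) - dot3 p (S q) := by
        simp only [dot3, Fin.sum_univ_three, Pi.sub_apply]; ring
      linarith
    have hnn' : ∀ p ∈ simplex3, 0 ≤ dot3 p (S p - S q) := by
      intro p hp
      by_cases h : p = q
      · subst h; simp [dot3]
      · exact (hnn p hp h).le
    let K := simplex3 ∩ {p | 0 ≤ dot3 p w}
    have hK : IsCompact K := simplex3_compact.inter_right (isClosed_le continuous_const hwc)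
    by_cases hne : K.Nonempty
    · obtain ⟨m, hm, hmin⟩ := hK.exists_isMinOn hne ((dot_cont hc (S q)).mono Set.inter_subset_left)
      obtain ⟨M, hM, hmax⟩ := hK.exists_isMaxOn hne hwc.continuousOn
      have hmp : 0 < dot3 m (S m - S q) := hnn m hm.1 (by
        rintro rfl; exact absurd hm.2 (not_le.2 hw))
      have hM0 : 0 ≤ dot3 M w := hM.2
      refine ⟨dot3 m (S m - S q) / (dot3 M w + 1), by positivity, fun ε he hlt p hp => ?_⟩
      rw [lt_div_iff₀ (by linarith)] at hlt
      rcases lt_or_ge (dot3 p w) 0 with h | h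
      · have := hnn' p hp
        have := mul_neg_of_pos_of_neg he h
        linarith
      · have h1 : dot3 m (S m - S q) ≤ dot3 p (S p - S q) := hmin (show p ∈ K from ⟨hp, h⟩)
        have h2 : dot3 p w ≤ dot3 M w := hmax (show p ∈ K from ⟨hp, h⟩)
        nlinarith
    · refine ⟨1, one_pos, fun ε he _ p hp => ?_⟩
      have h : dot3 p w < 0 := by
        by_contra h
        exact hne ⟨p, hp, not_lt.1 h⟩
      have := hnn' p hp
      have := mul_neg_of_pos_of_neg he h
      linarith
  obtain ⟨ε₀, h0, hk⟩ := key
  refine ⟨ε₀, h0, fun ε he hlt => ?_⟩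
  obtain ⟨r, hr, h⟩ := lemA hSP hc (S q + ε • w)
  refine ⟨r, hr, fun i => ?_⟩
  have h1 := hk ε he hlt r hr
  have h2 := h i
  have h3 : dot3 r (S r - (S q + ε • w)) = dot3 r (S r - S q) - ε * dot3 r w := by
    simp only [dot3, Fin.sum_univ_three, Pi.sub_apply, Pi.add_apply, Pi.smul_apply, smul_eq_mul]
    ring
  simp only [Pi.add_apply, Pi.smul_apply, smul_eq_mul] at h2
  linarith

/-- At the constrained optimum for the belief `e_j`, every other constraint binds. -/
theorem lemC {S : (Fin 3 → ℝ) → Fin 3 → ℝ} (hSP : StrictlyProper3 S)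
    (hc : ContinuousOn S simplex3) {j k : Fin 3} (hjk : k ≠ j) {q₀ q : Fin 3 → ℝ} {b : ℝ}
    (hq : q ∈ simplex3) (hqk : 0 < q k) (hf : nb3 S q₀ q ≤ b)
    (hopt : ∀ r ∈ simplex3, nb3 S q₀ r ≤ b → r ≠ q → S r j < S q j) :
    S q₀ k - S q k = b := by
  have hf' := nb3_le.1 hf
  by_contra hne
  have hlt : S q₀ k - S q k < b := lt_of_le_of_ne (hf' k) hne
  let w : Fin 3 → ℝ := fun i => if i = k then -(1 / q k) else 1
  have hw : dot3 q w < 0 := by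
    have h1 : dot3 q w = (∑ i, q i) + q k * (-(1 / q k) - 1) := by
      simp only [dot3, w]
      fin_cases k <;> simp [Fin.sum_univ_three] <;> ring
    rw [h1, hq.2]
    have : q k * (-(1 / q k) - 1) = -1 - q k := by field_simp
    linarith
  obtain ⟨ε₀, h0, hB⟩ := lemB hSP hc hq w hw
  set δ := (b - (S q₀ k - S q k)) * q k with hδ
  have hδp : 0 < δ := mul_pos (by linarith) hqk
  obtain ⟨r, hr, hri⟩ := hB (min ε₀ δ / 2) (by positivity)
    (by have := min_le_left ε₀ δ; have : 0 < min ε₀ δ := by positivity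
        linarith)
  have hε : min ε₀ δ / 2 < δ := by
    have := min_le_right ε₀ δ; linarith
  have hεp : 0 < min ε₀ δ / 2 := by positivity
  generalize min ε₀ δ / 2 = ε at *
  have hother : ∀ i, i ≠ k → S q i < S r i := by
    intro i hi
    have := hri i
    simp only [w, if_neg hi] at this
    linarith
  have hfe : nb3 S q₀ r ≤ b := by
    refine nb3_le.2 fun i => ?_
    by_cases hi : i = k
    · subst hi
      have h1 := hri i
      simp only [w, if_true] at h1
      have h2 : ε * (1 / q i) < b - (S q₀ i - S q i) := by
        rw [mul_one_div, div_lt_iff₀ hqk]; exact hε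
      linarith
    · linarith [hother i hi, hf' i]
  have h1 := hother j hjk.symm
  have h2 := hopt r hr hfe (by rintro rfl; exact lt_irrefl _ h1)
  linarith

theorem lemD {S : (Fin 3 → ℝ) → Fin 3 → ℝ} (hSP : StrictlyProper3 S)
    (hc : ContinuousOn S simplex3) (hBCT : BCT3 S) {i j k : Fin 3} (hij : i ≠ j) (hkj : k ≠ j)
    {q : Fin 3 → ℝ} (hq : q ∈ simplex3) (hqi : 0 < q i) (hqk : 0 < q k) :
    S q i - S q k = S (Pi.single j 1) i - S (Pi.single j 1) k := by
  set e : Fin 3 → ℝ := Pi.single j 1 with he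
  have hem : e ∈ simplex3 := single_mem j
  have hei : e i = 0 := by simp [he, hij]
  have hek : e k = 0 := by simp [he, hkj]
  let γ : ℝ → Fin 3 → ℝ := fun t => t • e + (1 - t) • q
  have hγc : Continuous γ := by fun_prop
  have hγm : Set.MapsTo γ (Set.Icc 0 1) simplex3 := fun t ht => simplex3_comb hem hq ht.1 ht.2
  have hγ0 : γ 0 = q := by simp [γ]
  have hγ1 : γ 1 = e := by simp [γ]
  let f : ℝ → ℝ := fun t => S (γ t) i - S (γ t) k
  have hfc : ContinuousOn f (Set.Icc 0 1) :=
    ((comp_cont hc i).comp hγc.continuousOn hγm).sub ((comp_cont hc k).comp hγc.continuousOn hγm)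
  let T := Set.Icc (0:ℝ) 1 ∩ f ⁻¹' {f 0}
  have hT : IsCompact T :=
    isCompact_Icc.of_isClosed_subset (hfc.preimage_isClosed_of_isClosed isClosed_Icc isClosed_singleton)
      Set.inter_subset_left
  obtain ⟨a, ha, hamax⟩ := hT.exists_isGreatest ⟨0, by simp, rfl⟩
  have hfa : f a = f 0 := ha.2
  rcases eq_or_lt_of_le ha.1.2 with h1 | h1
  · rw [h1] at hfa
    simp only [f, hγ0, hγ1] at hfa
    exact hfa.symm
  exfalso
  have ha0 := ha.1.1
  have hma := hγm ha.1
  have hval : ∀ t l, e l = 0 → γ t l = (1 - t) * q l := by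
    intro t l hl; simp [γ, hl]
  have hne : γ a ≠ e := by
    intro h
    have h2 := hval a i hei
    rw [h, hei] at h2
    have : 0 < (1 - a) * q i := mul_pos (by linarith) hqi
    linarith
  have hB := nb3_pos hSP hma hem hne
  obtain ⟨β, ⟨⟨hβ, hβf⟩, -⟩, hopt⟩ := hBCT e hem (γ a) hma (nb3 S (γ a) e / 2) (by linarith)
  have hβ1 : β < 1 := by
    refine lt_of_le_of_ne hβ.2 ?_
    rintro rfl
    simp only [one_smul, sub_self, zero_smul, add_zero] at hβf
    linarith
  have hβ0 := hβ.1
  have hcomp : β • e + (1 - β) • γ a = γ (β + (1 - β) * a) := by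
    ext l; simp only [γ, Pi.add_apply, Pi.smul_apply, smul_eq_mul]; ring
  rw [hcomp] at hβf hopt
  set t := β + (1 - β) * a with ht
  have ht1 : t < 1 := by nlinarith
  have htm : t ∈ Set.Icc (0:ℝ) 1 := ⟨by nlinarith, ht1.le⟩
  have hopt' : ∀ r ∈ simplex3, nb3 S (γ a) r ≤ nb3 S (γ a) e / 2 → r ≠ γ t → S r j < S (γ t) j := by
    intro r hr hrf hrn
    have := hopt r hr hrf hrn
    rwa [he, dot3_single, dot3_single] at this
  have bi := lemC hSP hc hij (hγm htm) (by rw [hval t i hei]; exact mul_pos (by linarith) hqi) hβf hopt'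
  have bk := lemC hSP hc hkj (hγm htm) (by rw [hval t k hek]; exact mul_pos (by linarith) hqk) hβf hopt'
  have hft : f t = f 0 := by
    rw [← hfa]; simp only [f]; linarith
  have hle : t ≤ a := hamax ⟨htm, hft⟩
  have hta : t = a := le_antisymm hle (by nlinarith)
  rw [hta] at bi
  linarith

theorem no_rule {S : (Fin 3 → ℝ) → Fin 3 → ℝ} (hSP : StrictlyProper3 S)
    (hc : ContinuousOn S simplex3) (hBCT : BCT3 S) : False := by
  have x2 : (![1/2, 1/4, 1/4] : Fin 3 → ℝ) 2 = 1/4 := rfl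
  have y2 : (![1/4, 1/2, 1/4] : Fin 3 → ℝ) 2 = 1/4 := rfl
  have hx : (![1/2, 1/4, 1/4] : Fin 3 → ℝ) ∈ simplex3 := by
    constructor
    · intro i; fin_cases i <;> norm_num
    · rw [Fin.sum_univ_three]; norm_num [x2, y2]
  have hy : (![1/4, 1/2, 1/4] : Fin 3 → ℝ) ∈ simplex3 := by
    constructor
    · intro i; fin_cases i <;> norm_num
    · rw [Fin.sum_univ_three]; norm_num [x2, y2]
  have hne : (![1/2, 1/4, 1/4] : Fin 3 → ℝ) ≠ ![1/4, 1/2, 1/4] := by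
    intro h; have := congrFun h 0; norm_num at this
  have h1 := hSP _ hx _ hy hne
  have h2 := hSP _ hy _ hx hne.symm
  have a1 := lemD hSP hc hBCT (i := 0) (j := 2) (k := 1) (by decide) (by decide) hx (by norm_num) (by norm_num [x2])
  have a2 := lemD hSP hc hBCT (i := 0) (j := 2) (k := 1) (by decide) (by decide) hy (by norm_num) (by norm_num [y2])
  have b1 := lemD hSP hc hBCT (i := 0) (j := 1) (k := 2) (by decide) (by decide) hx (by norm_num) (by norm_num [x2])
  have b2 := lemD hSP hc hBCT (i := 0) (j := 1) (k := 2) (by decide) (by decide) hy (by norm_num) (by norm_num [y2])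
  generalize S ![1/2, 1/4, 1/4] = A at *
  generalize S ![1/4, 1/2, 1/4] = B at *
  simp only [dot3, Fin.sum_univ_three, x2, y2] at h1 h2
  norm_num at h1 h2
  linarith

/-- Lemma `midpoint`: for a strictly proper scoring rule satisfying the technical
assumptions and the budget-constrained truthfulness property, for any pair `p, q₀ ∈ Δ`, setting
`q = ½p + ½q₀` and `b = nb(q₀, q)`, we have `b > 0` and `q` maximizes `p·S(·)` over the set of
feasible reports `{q' ∈ Δ : nb(q₀, q') ≤ b}`. -/
theorem stmt1 (S : (Fin 3 → ℝ) → Fin 3 → ℝ)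
    (hSP : StrictlyProper3 S) (hTech : Tech3 S) (hBCT : BCT3 S)
    (p q₀ : Fin 3 → ℝ) (hp : p ∈ simplex3) (hq₀ : q₀ ∈ simplex3)
    (q : Fin 3 → ℝ) (hq : q = (1/2 : ℝ) • p + (1/2 : ℝ) • q₀)
    (b : ℝ) (hb : b = nb3 S q₀ q) :
    0 < b ∧ ∀ q' ∈ simplex3, nb3 S q₀ q' ≤ b → dot3 p (S q') ≤ dot3 p (S q) := by
  exact (no_rule hSP hTech.1 hBCT).elim
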